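/- arXiv:0908.1427 — 2 statements merged into one kernel-verified Lean document; each statement's English description precedes it below -/
import Mathlib

section
/- For every real number t > 0, one has 2 · ∫₀^∞ sin(x t)/(e^{2πx} − 1) dx = (1/2) · coth(t/2) − 1/t, where coth denotes the real hyperbolic cotangent. -/
open MeasureTheory Real Set

/-- The real hyperbolic cotangent, `coth x = cosh x / sinh x`. -/
noncomputable def Real.coth (x : ℝ) : ℝ := Real.cosh x / Real.sinh x

theorem sin_mul_exp_eq_im (t b x : ℝ) :
    Real.sin (x * t) * Real.exp (-b * x) =
      RCLike.im (Complex.exp ((-b + t * Complex.I : ℂ) * x)) := by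
  rw [RCLike.im_to_complex, Complex.exp_im]
  simp [mul_comm]

theorem integrableOn_sin_mul_exp_neg_mul (t : ℝ) {b : ℝ} (hb : 0 < b) :
    IntegrableOn (fun x : ℝ => Real.sin (x * t) * Real.exp (-b * x)) (Ioi 0) := by
  simp_rw [sin_mul_exp_eq_im]
  exact (integrableOn_exp_mul_complex_Ioi (by simpa using hb) 0).im

theorem integral_sin_mul_exp_neg_mul (t : ℝ) {b : ℝ} (hb : 0 < b) :
    ∫ x in Ioi (0 : ℝ), Real.sin (x * t) * Real.exp (-b * x) = t / (t ^ 2 + b ^ 2) := by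
  have hre : (-b + t * Complex.I : ℂ).re < 0 := by simpa using hb
  simp_rw [sin_mul_exp_eq_im]
  rw [integral_im (integrableOn_exp_mul_complex_Ioi hre 0), integral_exp_mul_complex_Ioi hre]
  simp [Complex.div_im, Complex.normSq_apply]
  ring

theorem integral_norm_sin_mul_exp_neg_mul_le {t : ℝ} (ht : 0 < t) {b : ℝ} (hb : 0 < b) :
    ∫ x in Ioi (0 : ℝ), ‖Real.sin (x * t) * Real.exp (-b * x)‖ ≤ t / b ^ 2 := by
  have hint : IntegrableOn (fun x : ℝ => x * Real.exp (-b * x)) (Ioi 0) := by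
    simpa using integrableOn_rpow_mul_exp_neg_mul_rpow (p := 1) (s := 1) (by norm_num)
      one_pos hb
  have hval : ∫ x in Ioi (0 : ℝ), x * Real.exp (-b * x) = 1 / b ^ 2 := by
    have h := Real.integral_rpow_mul_exp_neg_mul_Ioi (a := 2) two_pos hb
    norm_num at h
    simpa using h
  calc ∫ x in Ioi (0 : ℝ), ‖Real.sin (x * t) * Real.exp (-b * x)‖
      ≤ ∫ x in Ioi (0 : ℝ), t * (x * Real.exp (-b * x)) := by
        refine setIntegral_mono_on (integrableOn_sin_mul_exp_neg_mul t hb).norm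
          (hint.const_mul t) measurableSet_Ioi fun x hx => ?_
        have hx : 0 < x := hx
        rw [norm_mul, Real.norm_eq_abs, Real.norm_eq_abs, Real.abs_exp, ← mul_assoc]
        gcongr
        calc |Real.sin (x * t)| ≤ |x * t| := Real.abs_sin_le_abs
          _ = t * x := by rw [abs_of_pos (by positivity), mul_comm]
    _ = t / b ^ 2 := by rw [integral_const_mul, hval, mul_one_div]

theorem tsum_exp_neg_mul_succ {y : ℝ} (hy : 0 < y) :
    ∑' n : ℕ, Real.exp (-((n + 1) * y)) = 1 / (Real.exp y - 1) := by
  have hlt : Real.exp (-y) < 1 := by simpa using hy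
  have hne : Real.exp y - 1 ≠ 0 := by
    have := Real.one_lt_exp_iff.2 hy
    linarith
  have hterm (n : ℕ) : Real.exp (-((n + 1) * y)) = Real.exp (-y) * Real.exp (-y) ^ n := by
    rw [← Real.exp_nat_mul, ← Real.exp_add]
    ring_nf
  simp_rw [hterm]
  rw [tsum_mul_left, tsum_geometric_of_lt_one (Real.exp_pos _).le hlt, Real.exp_neg]
  have hy0 := Real.exp_ne_zero y
  field_simp

/-- The Mittag-Leffler expansion of the hyperbolic cotangent. -/
theorem half_coth_half_sub_inv {t : ℝ} (ht : 0 < t) :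
    1 / 2 * Real.coth (t / 2) - 1 / t =
      ∑' n : ℕ, 2 * (t / (t ^ 2 + (2 * π * (n + 1)) ^ 2)) := by
  set z : ℂ := t / (2 * π) * Complex.I with hz
  have hpi : (π : ℂ) ≠ 0 := by exact_mod_cast Real.pi_ne_zero
  have ht0 : (t : ℂ) ≠ 0 := by exact_mod_cast ht.ne'
  have him : z.im = t / (2 * π) := by
    have : z = ((t / (2 * π) : ℝ) : ℂ) * Complex.I := by rw [hz]; push_cast; rfl
    rw [this, Complex.im_ofReal_mul]; simp
  have hmem : z ∈ Complex.integerComplement :=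
    UpperHalfPlane.coe_mem_integerComplement ⟨z, by rw [him]; positivity⟩
  have hcot : Complex.cot (π * z) = -Complex.I * Real.coth (t / 2) := by
    have harg : (π : ℂ) * z = (t / 2 : ℂ) * Complex.I := by
      rw [hz]; field_simp
    rw [harg, Complex.cot, Complex.cos_mul_I, Complex.sin_mul_I, Real.coth]
    push_cast
    rw [mul_comm (Complex.sinh _), ← div_div, Complex.div_I]
    ring
  have hseries := cot_series_rep' hmem
  have hterm (n : ℕ) : 1 / (z - (n + 1)) + 1 / (z + (n + 1)) =
      -(2 * π * Complex.I) * ((2 * (t / (t ^ 2 + (2 * π * (n + 1)) ^ 2)) : ℝ) : ℂ) := by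
    have h := cotTerm_identity hmem n
    rw [cotTerm] at h
    rw [h]
    have hden : ((t : ℂ) ^ 2 + (2 * π * (n + 1)) ^ 2) ≠ 0 := by
      have : t ^ 2 + (2 * π * (n + 1)) ^ 2 ≠ 0 := by positivity
      exact_mod_cast this
    have hprod : (z + (n + 1)) * (z - (n + 1)) =
        -(((t : ℂ) ^ 2 + (2 * π * (n + 1)) ^ 2) / (2 * π) ^ 2) := by
      rw [hz]
      field_simp
      ring_nf
      simp only [Complex.I_sq]
      ring
    rw [hprod, hz]
    push_cast
    field_simp
  simp_rw [hterm] at hseries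
  rw [tsum_mul_left, hcot, ← Complex.ofReal_tsum] at hseries
  have hinv : 1 / z = -(2 * π * Complex.I) * (1 / t) := by
    rw [hz, one_div, mul_inv, Complex.inv_I]
    field_simp
  rw [hinv] at hseries
  have hc : -(2 * π * Complex.I) ≠ 0 := by simp [hpi]
  have key : ((1 / 2 * Real.coth (t / 2) - 1 / t : ℝ) : ℂ) =
      ((∑' n : ℕ, 2 * (t / (t ^ 2 + (2 * π * (n + 1)) ^ 2)) : ℝ) : ℂ) := by
    apply mul_left_cancel₀ hc
    rw [← hseries]
    push_cast
    ring
  exact_mod_cast key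

theorem legendre_relation_coth (t : ℝ) (ht : 0 < t) :
    2 * ∫ x in Ioi (0 : ℝ), Real.sin (x * t) / (Real.exp (2 * π * x) - 1) =
      (1 / 2) * Real.coth (t / 2) - 1 / t := by
  have hb (n : ℕ) : 0 < 2 * π * ((n : ℝ) + 1) := by positivity
  have hsum : Summable fun n : ℕ =>
      ∫ x in Ioi (0 : ℝ), ‖Real.sin (x * t) * Real.exp (-(2 * π * ((n : ℝ) + 1)) * x)‖ := by
    refine Summable.of_nonneg_of_le (fun n => integral_nonneg fun x => norm_nonneg _)
      (fun n => integral_norm_sin_mul_exp_neg_mul_le ht (hb n)) ?_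
    have h : Summable fun n : ℕ => t / (2 * π) ^ 2 * (1 / ((n + 1 : ℕ) : ℝ) ^ 2) :=
      ((summable_nat_add_iff 1).2 (Real.summable_one_div_nat_pow.2 one_lt_two)).mul_left _
    refine h.congr fun n => ?_
    push_cast
    field_simp
  have hswap := integral_tsum_of_summable_integral_norm
    (fun n => integrableOn_sin_mul_exp_neg_mul t (hb n)) hsum
  have hintegrand : ∫ x in Ioi (0 : ℝ), Real.sin (x * t) / (Real.exp (2 * π * x) - 1) =
      ∫ x in Ioi (0 : ℝ),
        ∑' n : ℕ, Real.sin (x * t) * Real.exp (-(2 * π * ((n : ℝ) + 1)) * x) := by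
    refine setIntegral_congr_fun measurableSet_Ioi fun x hx => ?_
    have hx : 0 < x := hx
    have h := tsum_exp_neg_mul_succ (y := 2 * π * x) (by positivity)
    rw [tsum_mul_left, ← mul_one_div, ← h]
    congr 2 with n
    ring_nf
  simp_rw [hintegrand, ← hswap, integral_sin_mul_exp_neg_mul t (hb _)]
  rw [half_coth_half_sub_inv ht, tsum_mul_left]
end

section
/- Let s be a real number with s > 0 and s ≠ 1, and let u be a real number with 0 < u ≤ 1. Then ζ(s, u) = u^{-s}/2 + u^{1-s}/(s − 1) + 2 · ∫₀^∞ sin(s · arctan(x/u)) / ((u² + x²)^{s/2} (e^{2πx} − 1)) dx. -/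
open MeasureTheory Real Set

lemma mul_exp_half_le_exp_sub_one {y : ℝ} (hy : 0 ≤ y) : y * rexp (y / 2) ≤ rexp y - 1 := by
  have h1 : y / 2 ≤ Real.sinh (y / 2) := Real.self_le_sinh_iff.2 (by positivity)
  rw [Real.sinh_eq] at h1
  have h2 : rexp y = rexp (y / 2) * rexp (y / 2) := by rw [← Real.exp_add]; ring_nf
  have h3 : rexp (-(y / 2)) * rexp (y / 2) = 1 := by rw [← Real.exp_add]; simp
  nlinarith [Real.exp_pos (y / 2)]

lemma norm_sin_mul_div_exp_sub_one_le {x t : ℝ} (hx : 0 < x) (ht : 0 < t) :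
    ‖Real.sin (x * t) / (rexp (2 * π * x) - 1)‖ ≤ t * rexp (-π * x) := by
  have h1 := mul_exp_half_le_exp_sub_one (y := 2 * π * x) (by positivity)
  have h2 : 0 < 2 * π * x * rexp (2 * π * x / 2) := by positivity
  have h3 : |Real.sin (x * t)| ≤ x * t := by
    simpa [abs_of_pos (mul_pos hx ht)] using Real.abs_sin_le_abs (x := x * t)
  rw [norm_div, Real.norm_eq_abs, Real.norm_eq_abs, abs_of_pos (h2.trans_le h1),
    div_le_iff₀ (h2.trans_le h1)]
  have h4 : rexp (-π * x) * rexp (2 * π * x / 2) = 1 := by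
    rw [← Real.exp_add]; ring_nf; simp
  calc |Real.sin (x * t)| ≤ x * t := h3
    _ ≤ 2 * π * (x * t) := by nlinarith [Real.pi_gt_three, mul_pos hx ht]
    _ = t * (2 * π * x) * (rexp (-π * x) * rexp (2 * π * x / 2)) := by rw [h4]; ring
    _ = t * rexp (-π * x) * (2 * π * x * rexp (2 * π * x / 2)) := by ring
    _ ≤ _ := by gcongr

lemma integral_exp_neg_mul_mul_sin {a : ℝ} (ha : 0 < a) (t : ℝ) :
    ∫ x in Ioi (0 : ℝ), rexp (-a * x) * Real.sin (x * t) = t / (a ^ 2 + t ^ 2) := by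
  have hre : ((-a : ℂ) + t * Complex.I).re < 0 := by simpa using ha
  have h := integral_exp_mul_complex_Ioi hre 0
  have hi := integrableOn_exp_mul_complex_Ioi hre 0
  have := integral_im hi
  rw [h] at this
  calc _ = ∫ x in Ioi (0 : ℝ), RCLike.im (Complex.exp (((-a : ℂ) + t * Complex.I) * x)) := by
        congr 1 with x
        simp [Complex.exp_im, mul_comm]
    _ = _ := by
        rw [this]
        simp [Complex.div_im, Complex.normSq_apply]
        ring_nf

lemma integrableOn_exp_neg_mul_mul_sin {a : ℝ} (ha : 0 < a) (t : ℝ) :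
    IntegrableOn (fun x ↦ rexp (-a * x) * Real.sin (x * t)) (Ioi 0) := by
  refine (integrableOn_exp_mul_Ioi (neg_lt_zero.2 ha) 0).mono' (by fun_prop) (ae_of_all _ fun x ↦ ?_)
  rw [norm_mul, norm_of_nonneg (Real.exp_pos _).le]
  exact mul_le_of_le_one_right (Real.exp_pos _).le (by simpa using Real.abs_sin_le_one _)

lemma tsum_div_sq_add_sq {t : ℝ} (ht : 0 < t) :
    ∑' n : ℕ, t / ((2 * π * (n + 1)) ^ 2 + t ^ 2) =
      (1 / (1 - rexp (-t)) - 1 / 2 - 1 / t) / 2 := by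
  have hx : ((t / (2 * π) : ℝ) : ℂ) * Complex.I ∈ Complex.integerComplement := by
    rintro ⟨n, hn⟩
    have := congrArg Complex.im hn
    rw [Complex.im_ofReal_mul] at this
    simp only [Complex.intCast_im, Complex.I_im, mul_one] at this
    exact (div_pos ht Real.two_pi_pos).ne this
  have h := cot_series_rep' hx
  have hq : (1 : ℂ) - Complex.exp (-t) ≠ 0 := by
    have : rexp (-t) < 1 := by simpa using ht
    exact_mod_cast (sub_pos.2 this).ne'
  have hpi : (π : ℂ) ≠ 0 := by exact_mod_cast Real.pi_ne_zero
  have htc : (t : ℂ) ≠ 0 := by exact_mod_cast ht.ne'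
  have harg : 2 * Complex.I * (π * (((t / (2 * π) : ℝ) : ℂ) * Complex.I)) = -t := by
    push_cast
    field_simp
    simp
  rw [Complex.cot_eq_exp_ratio, harg] at h
  have hterm (n : ℕ) : 1 / (((t / (2 * π) : ℝ) : ℂ) * Complex.I - (n + 1)) +
      1 / (((t / (2 * π) : ℝ) : ℂ) * Complex.I + (n + 1)) =
      -(4 * π * Complex.I) * ((t / ((2 * π * (n + 1)) ^ 2 + t ^ 2) : ℝ) : ℂ) := by
    have h1 : ((2 * π * (n + 1)) ^ 2 + t ^ 2 : ℂ) ≠ 0 := by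
      have : (2 * π * (n + 1)) ^ 2 + t ^ 2 ≠ 0 := by positivity
      exact_mod_cast this
    have h2 : ((t / (2 * π) : ℝ) : ℂ) * Complex.I - (n + 1) ≠ 0 := fun h0 ↦
      hx ⟨n + 1, by simpa using (sub_eq_zero.1 h0).symm⟩
    have h3 : ((t / (2 * π) : ℝ) : ℂ) * Complex.I + (n + 1) ≠ 0 := fun h0 ↦
      hx ⟨-(n + 1), by simpa using (eq_neg_of_add_eq_zero_left h0).symm⟩
    rw [div_add_div _ _ h2 h3]
    push_cast at h2 h3 ⊢
    rw [← mul_div_assoc, div_eq_div_iff (mul_ne_zero h2 h3) h1]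
    field_simp
    ring_nf
    simp only [Complex.I_pow_three]
    ring_nf
  simp_rw [hterm] at h
  rw [tsum_mul_left, ← Complex.ofReal_tsum] at h
  have h4 : (4 * π * Complex.I : ℂ) ≠ 0 := by simp [Real.pi_ne_zero]
  apply Complex.ofReal_injective
  apply mul_left_cancel₀ (neg_ne_zero.2 h4)
  rw [← h]
  push_cast
  field_simp
  ring_nf
  simp only [Complex.I_sq]
  ring_nf

lemma integral_sin_mul_div_exp_sub_one {t : ℝ} (ht : 0 < t) :
    ∫ x in Ioi (0 : ℝ), Real.sin (x * t) / (rexp (2 * π * x) - 1) =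
      (1 / (1 - rexp (-t)) - 1 / 2 - 1 / t) / 2 := by
  have hp (n : ℕ) : 0 < 2 * π * (n + 1) := by positivity
  have hS : Summable fun n : ℕ ↦
      ∫ x in Ioi (0 : ℝ), ‖rexp (-(2 * π * (n + 1)) * x) * Real.sin (x * t)‖ := by
    have hsum : Summable fun n : ℕ ↦ t * (1 / ((n + 1 : ℕ) : ℝ) ^ 2) :=
      ((summable_nat_add_iff 1).2 (Real.summable_one_div_nat_pow.2 one_lt_two)).mul_left t
    refine hsum.of_nonneg_of_le (fun n ↦ integral_nonneg fun _ ↦ norm_nonneg _) fun n ↦ ?_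
    have hG := Real.integral_rpow_mul_exp_neg_mul_Ioi two_pos (hp n)
    have hGi := integrableOn_rpow_mul_exp_neg_mul_rpow (s := 1) (p := 1) (by norm_num) one_pos (hp n)
    norm_num at hG hGi
    calc _ ≤ ∫ x in Ioi (0 : ℝ), t * (x * rexp (-(2 * π * (n + 1) * x))) := by
          refine setIntegral_mono_on (integrableOn_exp_neg_mul_mul_sin (hp n) t).norm
            (hGi.const_mul t) measurableSet_Ioi fun x (hx : 0 < x) ↦ ?_
          rw [norm_mul, norm_of_nonneg (Real.exp_pos _).le, Real.norm_eq_abs, neg_mul]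
          calc _ ≤ rexp (-(2 * π * (n + 1) * x)) * (x * t) := by
                gcongr
                simpa [abs_of_pos (mul_pos hx ht)] using Real.abs_sin_le_abs (x := x * t)
            _ = _ := by ring
      _ = t * (1 / ((n + 1 : ℕ) : ℝ) ^ 2 * (π⁻¹ * (1 / 2)) ^ 2) := by
          rw [integral_const_mul, hG]
          push_cast
          field_simp
      _ ≤ t * (1 / ((n + 1 : ℕ) : ℝ) ^ 2) := by
          have : π⁻¹ * (1 / 2) ≤ 1 := by
            have : π⁻¹ ≤ 1 := inv_le_one_of_one_le₀ (by linarith [Real.pi_gt_three])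
            linarith
          gcongr
          exact mul_le_of_le_one_right (by positivity) (pow_le_one₀ (by positivity) this)
  have key := hasSum_integral_of_summable_integral_norm
    (fun n : ℕ ↦ integrableOn_exp_neg_mul_mul_sin (hp n) t) hS
  simp_rw [integral_exp_neg_mul_mul_sin (hp _)] at key
  rw [← tsum_div_sq_add_sq ht, key.tsum_eq]
  refine setIntegral_congr_fun measurableSet_Ioi fun x (hx : 0 < x) ↦ ?_
  have hq : rexp (-(2 * π * x)) < 1 := by rw [Real.exp_lt_one_iff]; simp; positivity
  have : ∀ n : ℕ, rexp (-(2 * π * (n + 1)) * x) * Real.sin (x * t) =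
      rexp (-(2 * π * x)) ^ n * (rexp (-(2 * π * x)) * Real.sin (x * t)) := by
    intro n
    rw [← mul_assoc, ← pow_succ, ← Real.exp_nat_mul]
    push_cast
    ring_nf
  simp_rw [this]
  rw [tsum_mul_right, tsum_geometric_of_lt_one (Real.exp_pos _).le hq, Real.exp_neg]
  have h1 : 1 < rexp (2 * π * x) := by rw [Real.one_lt_exp_iff]; positivity
  have h2 : rexp (2 * π * x) - 1 ≠ 0 := by linarith
  field_simp

lemma integrableOn_rpow_mul_exp_neg_mul {p b : ℝ} (hp : -1 < p) (hb : 0 < b) :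
    IntegrableOn (fun t : ℝ ↦ t ^ p * rexp (-b * t)) (Ioi 0) := by
  simpa using integrableOn_rpow_mul_exp_neg_mul_rpow hp one_pos hb

lemma norm_cpow_mul_cexp_neg_mul {t : ℝ} (ht : 0 < t) (a r : ℂ) :
    ‖(t : ℂ) ^ (a - 1) * Complex.exp (-(r * t))‖ = t ^ (a.re - 1) * rexp (-r.re * t) := by
  rw [norm_mul, Complex.norm_cpow_eq_rpow_re_of_pos ht, Complex.norm_exp]
  simp

lemma continuousOn_cpow_mul_cexp_neg_mul (a r : ℂ) :
    ContinuousOn (fun t : ℝ ↦ (t : ℂ) ^ a * Complex.exp (-(r * t))) (Ioi 0) := by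
  refine ContinuousOn.mul (fun t (ht : 0 < t) ↦ ?_) (by fun_prop)
  exact (Complex.continuousAt_ofReal_cpow_const _ _ (.inr ht.ne')).continuousWithinAt

lemma integrableOn_cpow_mul_cexp_neg_mul {a : ℂ} (ha : 0 < a.re) {r : ℂ} (hr : 0 < r.re) :
    IntegrableOn (fun t : ℝ ↦ (t : ℂ) ^ (a - 1) * Complex.exp (-(r * t))) (Ioi 0) :=
  (integrableOn_rpow_mul_exp_neg_mul (p := a.re - 1) (by linarith) hr).mono'
    ((continuousOn_cpow_mul_cexp_neg_mul _ r).aestronglyMeasurable measurableSet_Ioi)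
    ((ae_restrict_iff' measurableSet_Ioi).2 <| ae_of_all _ fun _ ht ↦
      (norm_cpow_mul_cexp_neg_mul ht a r).le)

lemma differentiableAt_integral_cpow_mul_cexp_neg_mul {a : ℂ} (ha : 0 < a.re) {r : ℂ}
    (hr : 0 < r.re) :
    DifferentiableAt ℂ (fun r : ℂ ↦
      ∫ t in Ioi (0 : ℝ), (t : ℂ) ^ (a - 1) * Complex.exp (-(r * t))) r := by
  have hU : {z : ℂ | r.re / 2 < z.re} ∈ nhds r :=
    (isOpen_lt continuous_const Complex.continuous_re).mem_nhds (by simp [hr])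
  refine (hasDerivAt_integral_of_dominated_loc_of_deriv_le
    (F := fun z (t : ℝ) ↦ (t : ℂ) ^ (a - 1) * Complex.exp (-(z * t)))
    (F' := fun z (t : ℝ) ↦ (t : ℂ) ^ (a - 1) * (Complex.exp (-(z * t)) * -(t : ℂ)))
    (bound := fun t ↦ t ^ a.re * rexp (-(r.re / 2) * t)) hU ?_
    (integrableOn_cpow_mul_cexp_neg_mul ha hr) ?_ ?_
    (integrableOn_rpow_mul_exp_neg_mul (by linarith) (by linarith)) ?_).2.differentiableAt
  · exact Filter.Eventually.of_forall fun z ↦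
      (continuousOn_cpow_mul_cexp_neg_mul _ z).aestronglyMeasurable measurableSet_Ioi
  · simp_rw [← mul_assoc]
    exact ((continuousOn_cpow_mul_cexp_neg_mul _ r).mul
      (by fun_prop)).aestronglyMeasurable measurableSet_Ioi
  · refine (ae_restrict_iff' measurableSet_Ioi).2 <| ae_of_all _ fun t (ht : 0 < t) z hz ↦ ?_
    have hz : r.re / 2 < z.re := hz
    rw [← mul_assoc, norm_mul, norm_cpow_mul_cexp_neg_mul ht, norm_neg, Complex.norm_real,
      norm_of_nonneg ht.le, Real.rpow_sub_one ht.ne']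
    have : rexp (-z.re * t) ≤ rexp (-(r.re / 2) * t) := by gcongr
    calc _ = t ^ a.re * rexp (-z.re * t) := by field_simp
      _ ≤ _ := by gcongr
  · refine ae_of_all _ fun t z _ ↦ ?_
    have : HasDerivAt (fun z : ℂ ↦ -(z * t)) (-(t : ℂ)) z := by
      simpa using! ((hasDerivAt_id z).mul_const (t : ℂ)).neg
    exact this.cexp.const_mul _

lemma integral_cpow_mul_cexp_neg_mul {a : ℂ} (ha : 0 < a.re) {r : ℂ} (hr : 0 < r.re) :
    ∫ t in Ioi (0 : ℝ), (t : ℂ) ^ (a - 1) * Complex.exp (-(r * t)) =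
      r ^ (-a) * Complex.Gamma a := by
  have hopen : IsOpen {z : ℂ | 0 < z.re} := isOpen_lt continuous_const Complex.continuous_re
  have hf : AnalyticOnNhd ℂ (fun r : ℂ ↦
      ∫ t in Ioi (0 : ℝ), (t : ℂ) ^ (a - 1) * Complex.exp (-(r * t))) {z : ℂ | 0 < z.re} :=
    DifferentiableOn.analyticOnNhd (fun z hz ↦
      (differentiableAt_integral_cpow_mul_cexp_neg_mul ha hz).differentiableWithinAt) hopen
  have hg : AnalyticOnNhd ℂ (fun r : ℂ ↦ r ^ (-a) * Complex.Gamma a) {z : ℂ | 0 < z.re} :=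
    DifferentiableOn.analyticOnNhd (fun z hz ↦ ((differentiableAt_id.cpow_const
      (.inl hz)).mul_const _).differentiableWithinAt) hopen
  refine hf.eqOn_of_preconnected_of_frequently_eq hg (convex_halfSpace_re_gt 0).isPreconnected
    (z₀ := 1) (by simp) ?_ hr
  have hT : Filter.Tendsto (fun x : ℝ ↦ (x : ℂ)) (nhdsWithin 1 {1}ᶜ) (nhdsWithin 1 {1}ᶜ) := by
    refine Filter.Tendsto.inf ?_ ?_
    · simpa using Complex.continuous_ofReal.tendsto 1
    · simp
  refine hT.frequently (Filter.Eventually.frequently ?_)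
  filter_upwards [nhdsWithin_le_nhds (lt_mem_nhds (zero_lt_one (α := ℝ)))] with x hx
  have := Complex.integral_cpow_mul_exp_neg_mul_Ioi ha hx
  rw [this, one_div, Complex.cpow_neg, Complex.inv_cpow]
  rw [Complex.arg_ofReal_of_nonneg hx.le]
  exact Real.pi_pos.ne

lemma arg_sub_mul_I {u : ℝ} (hu : 0 < u) (x : ℝ) :
    Complex.arg (u - x * Complex.I) = -Real.arctan (x / u) := by
  have hn : ‖(u - x * Complex.I : ℂ)‖ = u * √(1 + (x / u) ^ 2) := by
    rw [Complex.norm_eq_sqrt_sq_add_sq, ← Real.sqrt_sq hu.le, ← Real.sqrt_mul (by positivity),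
      Real.sqrt_sq hu.le]
    congr 1
    simp
    field_simp
  rw [Complex.arg_of_re_nonneg (by simpa using hu.le), hn, Real.arctan_eq_arcsin, ← Real.arcsin_neg]
  congr 1
  simp
  field_simp

lemma integral_rpow_mul_exp_neg_mul_mul_sin {s u : ℝ} (hs : 0 < s) (hu : 0 < u) (x : ℝ) :
    ∫ t in Ioi (0 : ℝ), t ^ (s - 1) * rexp (-u * t) * Real.sin (x * t) =
      Real.Gamma s * (Real.sin (s * Real.arctan (x / u)) / (u ^ 2 + x ^ 2) ^ (s / 2)) := by
  have hr : 0 < (u - x * Complex.I : ℂ).re := by simpa using hu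
  have h := integral_im (integrableOn_cpow_mul_cexp_neg_mul (a := s) (by simpa using hs) hr)
  rw [integral_cpow_mul_cexp_neg_mul (by simpa using hs) hr] at h
  have hne : (u - x * Complex.I : ℂ) ≠ 0 := fun h0 ↦ by simp [h0] at hr
  have hn : ‖(u - x * Complex.I : ℂ)‖ = √(u ^ 2 + x ^ 2) := by
    rw [Complex.norm_eq_sqrt_sq_add_sq]; simp
  have hlog : Real.log (√(u ^ 2 + x ^ 2)) = Real.log (u ^ 2 + x ^ 2) / 2 :=
    Real.log_sqrt (by positivity)
  calc _ = ∫ t in Ioi (0 : ℝ), RCLike.im ((t : ℂ) ^ ((s : ℂ) - 1) *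
          Complex.exp (-((u - x * Complex.I : ℂ) * t))) := by
        refine setIntegral_congr_fun measurableSet_Ioi fun t (ht : 0 < t) ↦ ?_
        have : (t : ℂ) ^ ((s : ℂ) - 1) = ((t ^ (s - 1) : ℝ) : ℂ) := by
          rw [Complex.ofReal_cpow ht.le]; simp
        simp [this, Complex.exp_im, mul_assoc]
    _ = _ := by
        rw [h, Complex.cpow_def_of_ne_zero hne, Complex.Gamma_ofReal, Complex.log, hn, hlog,
          arg_sub_mul_I hu]
        have : (Complex.exp (((Real.log (u ^ 2 + x ^ 2) / 2 : ℝ) +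
            (-Real.arctan (x / u) : ℝ) * Complex.I) * -(s : ℂ))).im =
            Real.sin (s * Real.arctan (x / u)) / (u ^ 2 + x ^ 2) ^ (s / 2) := by
          rw [Real.rpow_def_of_pos (by positivity), div_eq_mul_inv (Real.sin _), ← Real.exp_neg,
            Complex.exp_im]
          simp only [Complex.mul_re, Complex.mul_im, Complex.add_re, Complex.add_im,
            Complex.ofReal_re, Complex.ofReal_im, Complex.I_re, Complex.I_im, Complex.neg_re,
            Complex.neg_im]
          ring_nf
        rw [← this, mul_comm (Real.Gamma s)]
        exact Complex.im_mul_ofReal _ _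

/-- The function `t ↦ 1 / (1 - e⁻ᵗ) - 1 / 2 - 1 / t`, that is the Bose kernel with its
polar and constant parts at the origin removed. -/
noncomputable def boseRemainder (t : ℝ) : ℝ := 1 / (1 - rexp (-t)) - 1 / 2 - 1 / t

lemma boseRemainder_eq_integral {t : ℝ} (ht : 0 < t) :
    boseRemainder t = 2 * ∫ x in Ioi (0 : ℝ), Real.sin (x * t) / (rexp (2 * π * x) - 1) := by
  rw [integral_sin_mul_div_exp_sub_one ht, boseRemainder]
  ring

lemma abs_boseRemainder_le {t : ℝ} (ht : 0 < t) : |boseRemainder t| ≤ t := by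
  have hint : IntegrableOn (fun x ↦ t * rexp (-π * x)) (Ioi 0) :=
    (integrableOn_exp_mul_Ioi (neg_lt_zero.2 Real.pi_pos) 0).const_mul t
  have h := norm_integral_le_of_norm_le hint ((ae_restrict_iff' measurableSet_Ioi).2 <|
    ae_of_all _ fun x (hx : 0 < x) ↦ norm_sin_mul_div_exp_sub_one_le hx ht)
  rw [integral_const_mul, integral_exp_mul_Ioi (neg_lt_zero.2 Real.pi_pos)] at h
  rw [boseRemainder_eq_integral ht, abs_mul, abs_two, ← Real.norm_eq_abs]
  have h2 : 2 / π ≤ 1 := by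
    rw [div_le_one Real.pi_pos]
    linarith [Real.pi_gt_three]
  calc _ ≤ 2 * (t * (-rexp (-π * 0) / -π)) := by gcongr
    _ = t * (2 / π) := by simp; ring
    _ ≤ t := mul_le_of_le_one_right ht.le h2

lemma continuousOn_boseRemainder : ContinuousOn boseRemainder (Ioi 0) := by
  unfold boseRemainder
  refine ((continuousOn_const.div (by fun_prop) fun t (ht : 0 < t) ↦ ?_).sub
    continuousOn_const).sub (continuousOn_const.div continuousOn_id fun t (ht : 0 < t) ↦ ht.ne')
  have : rexp (-t) < 1 := by simpa using ht
  linarith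

lemma integral_rpow_mul_exp_neg_mul_mul_boseRemainder {s u : ℝ} (hs : 0 < s) (hu : 0 < u) :
    ∫ t in Ioi (0 : ℝ), t ^ (s - 1) * (rexp (-u * t) * boseRemainder t) =
      Real.Gamma s * (2 * ∫ x in Ioi (0 : ℝ), Real.sin (s * Real.arctan (x / u)) /
          ((u ^ 2 + x ^ 2) ^ (s / 2) * (rexp (2 * π * x) - 1))) := by
  let f : ℝ → ℝ → ℝ := fun t x ↦
    t ^ (s - 1) * rexp (-u * t) * (Real.sin (x * t) / (rexp (2 * π * x) - 1))
  have hf : Integrable (Function.uncurry f)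
      ((volume.restrict (Ioi 0)).prod (volume.restrict (Ioi 0))) := by
    have h1 := (integrableOn_rpow_mul_exp_neg_mul (p := s) (by linarith) hu).mul_prod
      (integrableOn_exp_mul_Ioi (neg_lt_zero.2 Real.pi_pos) 0)
    refine h1.mono' ?_ ?_
    · apply Measurable.aestronglyMeasurable
      simp only [f, Function.uncurry_def]
      fun_prop
    · rw [Measure.prod_restrict]
      refine (ae_restrict_iff' (measurableSet_Ioi.prod measurableSet_Ioi)).2 <|
        ae_of_all _ fun ⟨t, x⟩ ⟨(ht : 0 < t), (hx : 0 < x)⟩ ↦ ?_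
      simp only [f, Function.uncurry_def]
      rw [norm_mul, norm_of_nonneg (by positivity)]
      calc _ ≤ t ^ (s - 1) * rexp (-u * t) * (t * rexp (-π * x)) := by
            gcongr
            exact norm_sin_mul_div_exp_sub_one_le hx ht
        _ = _ := by
            rw [Real.rpow_sub_one ht.ne']
            field_simp
  calc _ = ∫ t in Ioi (0 : ℝ), 2 * ∫ x in Ioi (0 : ℝ), f t x := by
        refine setIntegral_congr_fun measurableSet_Ioi fun t (ht : 0 < t) ↦ ?_
        simp only [f]
        rw [boseRemainder_eq_integral ht, integral_const_mul]
        ring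
    _ = 2 * ∫ x in Ioi (0 : ℝ), ∫ t in Ioi (0 : ℝ), f t x := by
        rw [integral_const_mul, integral_integral_swap hf]
    _ = 2 * ∫ x in Ioi (0 : ℝ), Real.Gamma s * (Real.sin (s * Real.arctan (x / u)) /
          ((u ^ 2 + x ^ 2) ^ (s / 2) * (rexp (2 * π * x) - 1))) := by
        congr 2 with x
        simp only [f]
        simp_rw [← mul_div_assoc]
        rw [integral_div, integral_rpow_mul_exp_neg_mul_mul_sin hs hu]
        simp only [div_eq_mul_inv, mul_inv]
        ring
    _ = _ := by
        rw [integral_const_mul]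
        ring

lemma isBigO_exp_neg_mul_mul_boseRemainder_atTop {u : ℝ} (hu : 0 < u) :
    (fun t : ℝ ↦ ((rexp (-u * t) * boseRemainder t : ℝ) : ℂ)) =O[Filter.atTop]
      fun t ↦ rexp (-(u / 2) * t) := by
  refine Asymptotics.IsBigO.of_bound (2 / u) ?_
  filter_upwards [Filter.eventually_gt_atTop 0] with t ht
  rw [Complex.norm_real, norm_mul, norm_of_nonneg (Real.exp_pos _).le,
    norm_of_nonneg (Real.exp_pos _).le, Real.norm_eq_abs]
  have h1 : u / 2 * t ≤ rexp (u / 2 * t) := by linarith [Real.add_one_le_exp (u / 2 * t)]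
  have h2 : rexp (-u * t) * rexp (u / 2 * t) = rexp (-(u / 2) * t) := by
    rw [← Real.exp_add]
    ring_nf
  calc _ ≤ rexp (-u * t) * t := by
        gcongr
        exact abs_boseRemainder_le ht
    _ = 2 / u * (rexp (-u * t) * (u / 2 * t)) := by field_simp
    _ ≤ 2 / u * (rexp (-u * t) * rexp (u / 2 * t)) := by gcongr
    _ = _ := by rw [h2]

lemma isBigO_exp_neg_mul_mul_boseRemainder_zero {u : ℝ} (hu : 0 < u) :
    (fun t : ℝ ↦ ((rexp (-u * t) * boseRemainder t : ℝ) : ℂ)) =O[nhdsWithin 0 (Ioi 0)]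
      fun t : ℝ ↦ t ^ (-(0 : ℝ)) := by
  refine Asymptotics.IsBigO.of_bound 1 ?_
  filter_upwards [Ioo_mem_nhdsGT (zero_lt_one (α := ℝ))] with t ⟨ht, ht1⟩
  rw [Complex.norm_real, norm_mul, norm_of_nonneg (Real.exp_pos _).le, Real.norm_eq_abs]
  have h1 : rexp (-u * t) ≤ 1 := by
    rw [Real.exp_le_one_iff]
    nlinarith
  simpa using mul_le_one₀ h1 (abs_nonneg _) ((abs_boseRemainder_le ht).trans ht1.le)

lemma locallyIntegrableOn_exp_neg_mul_mul_boseRemainder (u : ℝ) :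
    LocallyIntegrableOn (fun t : ℝ ↦ ((rexp (-u * t) * boseRemainder t : ℝ) : ℂ)) (Ioi 0) := by
  refine ContinuousOn.locallyIntegrableOn ?_ measurableSet_Ioi
  exact Complex.continuous_ofReal.comp_continuousOn
    (ContinuousOn.mul (by fun_prop) continuousOn_boseRemainder)

lemma hasMellin_exp_neg_mul {u : ℝ} (hu : 0 < u) {s : ℂ} (hs : 0 < s.re) :
    HasMellin (fun t : ℝ ↦ ((rexp (-u * t) : ℝ) : ℂ)) s ((u : ℂ) ^ (-s) * Complex.Gamma s) := by
  have hr : 0 < (u : ℂ).re := hu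
  have h : ∀ t : ℝ, (t : ℂ) ^ (s - 1) • ((rexp (-u * t) : ℝ) : ℂ) =
      (t : ℂ) ^ (s - 1) * Complex.exp (-(u * t)) := by simp
  simp_rw [HasMellin, MellinConvergent, mellin, h]
  exact ⟨integrableOn_cpow_mul_cexp_neg_mul hs hr, integral_cpow_mul_cexp_neg_mul hs hr⟩

lemma hasMellin_exp_neg_mul_div {u : ℝ} (hu : 0 < u) {s : ℂ} (hs : 1 < s.re) :
    HasMellin (fun t : ℝ ↦ ((rexp (-u * t) / t : ℝ) : ℂ)) s
      ((u : ℂ) ^ (1 - s) * Complex.Gamma (s - 1)) := by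
  have hr : 0 < (u : ℂ).re := hu
  have hs' : 0 < (s - 1).re := by simpa using hs
  have h : EqOn (fun t : ℝ ↦ (t : ℂ) ^ (s - 1) • ((rexp (-u * t) / t : ℝ) : ℂ))
      (fun t : ℝ ↦ (t : ℂ) ^ (s - 1 - 1) * Complex.exp (-(u * t))) (Ioi 0) := by
    intro t (ht : 0 < t)
    have htc : (t : ℂ) ≠ 0 := by exact_mod_cast ht.ne'
    simp only [smul_eq_mul]
    rw [Complex.cpow_sub (s - 1) 1 htc, Complex.cpow_one]
    push_cast
    rw [neg_mul]
    ring
  rw [HasMellin, MellinConvergent, mellin, integrableOn_congr_fun h measurableSet_Ioi,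
    setIntegral_congr_fun measurableSet_Ioi h, integral_cpow_mul_cexp_neg_mul hs' hr, neg_sub]
  exact ⟨integrableOn_cpow_mul_cexp_neg_mul hs' hr, rfl⟩

lemma mellin_exp_neg_mul_div_one_sub_exp {u : ℝ} (hu : 0 < u) (hu1 : u ≤ 1) {s : ℂ}
    (hs : 1 < s.re) :
    mellin (fun t : ℝ ↦ ((rexp (-u * t) / (1 - rexp (-t)) : ℝ) : ℂ)) s =
      Complex.Gamma s * HurwitzZeta.hurwitzZeta u s := by
  have hz := HurwitzZeta.hasSum_hurwitzZeta_of_one_lt_re (a := u) ⟨hu.le, hu1⟩ hs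
  have h := hasSum_mellin (a := fun _ : ℕ ↦ 1) (p := fun n : ℕ ↦ n + u) (s := s)
    (F := fun t : ℝ ↦ ((rexp (-u * t) / (1 - rexp (-t)) : ℝ) : ℂ))
    (fun n ↦ .inr (by positivity)) (by linarith) (fun t (ht : 0 < t) ↦ ?_) ?_
  · refine h.unique ?_
    convert! hz.mul_left (Complex.Gamma s) using 2 with n
    push_cast
    ring
  · have hq : rexp (-t) < 1 := by simpa using ht
    have hg := (hasSum_geometric_of_lt_one (Real.exp_pos _).le hq).mul_left (rexp (-u * t))
    have := Complex.hasSum_ofReal.2 hg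
    rw [← div_eq_mul_inv] at this
    convert this using 2 with n
    rw [← Real.exp_nat_mul, ← Real.exp_add, one_mul]
    congr 2
    ring
  · have := hz.summable.norm
    refine this.congr fun n ↦ ?_
    have h0 : 0 < (n : ℝ) + u := by positivity
    rw [norm_div, ← Complex.norm_cpow_eq_rpow_re_of_pos h0]
    simp

lemma hurwitzZeta_eq_of_one_lt_re {u : ℝ} (hu : 0 < u) (hu1 : u ≤ 1) {s : ℂ} (hs : 1 < s.re) :
    HurwitzZeta.hurwitzZeta u s = (u : ℂ) ^ (-s) / 2 + (u : ℂ) ^ (1 - s) / (s - 1) +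
      mellin (fun t : ℝ ↦ ((rexp (-u * t) * boseRemainder t : ℝ) : ℂ)) s *
        (1 / Complex.Gamma s) := by
  have hk : MellinConvergent (fun t : ℝ ↦ ((rexp (-u * t) * boseRemainder t : ℝ) : ℂ)) s :=
    mellinConvergent_of_isBigO_rpow_exp (half_pos hu)
      (locallyIntegrableOn_exp_neg_mul_mul_boseRemainder u)
      (isBigO_exp_neg_mul_mul_boseRemainder_atTop hu)
      (isBigO_exp_neg_mul_mul_boseRemainder_zero hu) (by linarith)
  have h1 := hasMellin_exp_neg_mul hu (s := s) (by linarith)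
  have h2 := hasMellin_exp_neg_mul_div hu hs
  have h3 := hasMellin_add (hasMellin_add hk h2.1).1 (h1.1.const_smul (1 / 2 : ℂ))
  have h4 : mellin (fun t : ℝ ↦ ((rexp (-u * t) / (1 - rexp (-t)) : ℝ) : ℂ)) s = _ :=
    Eq.trans (by congr 1 with t; simp only [boseRemainder]; push_cast; simp; ring) h3.2
  rw [(hasMellin_add hk h2.1).2, mellin_const_smul, h1.2, h2.2,
    mellin_exp_neg_mul_div_one_sub_exp hu hu1 hs] at h4
  have hs1 : s - 1 ≠ 0 := fun h ↦ by
    rw [sub_eq_zero.1 h] at hs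
    simp at hs
  have hG : Complex.Gamma s = (s - 1) * Complex.Gamma (s - 1) := by
    simpa using Complex.Gamma_add_one (s - 1) hs1
  have hG0 : Complex.Gamma s ≠ 0 := Complex.Gamma_ne_zero_of_re_pos (by linarith)
  have hG1 : Complex.Gamma (s - 1) ≠ 0 := right_ne_zero_of_mul (hG ▸ hG0)
  apply mul_left_cancel₀ hG0
  rw [h4, hG]
  simp
  field_simp
  ring

lemma isPreconnected_re_pos_diff_one : IsPreconnected ({s : ℂ | 0 < s.re} \ {1}) := by
  have h1 : IsPreconnected ({s : ℂ | 0 < s.re} ∩ {s | 0 < s.im}) :=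
    ((convex_halfSpace_re_gt 0).inter (convex_halfSpace_im_gt 0)).isPreconnected
  have h2 : IsPreconnected ({s : ℂ | 0 < s.re} ∩ {s | s.im < 0}) :=
    ((convex_halfSpace_re_gt 0).inter (convex_halfSpace_im_lt 0)).isPreconnected
  have h3 : IsPreconnected ({s : ℂ | 0 < s.re} ∩ {s | s.re < 1}) :=
    ((convex_halfSpace_re_gt 0).inter (convex_halfSpace_re_lt 1)).isPreconnected
  have h4 : IsPreconnected {s : ℂ | 1 < s.re} := (convex_halfSpace_re_gt 1).isPreconnected
  have h5 := h1.union ⟨2, 1⟩ (by simp) (by simp) h4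
  have h6 := h2.union ⟨1 / 2, -1⟩ (by simp) (by norm_num) h3
  have h7 := h5.union ⟨2, -1⟩ (by simp) (by simp) h6
  convert h7 using 1
  ext s
  simp only [mem_sdiff, mem_ofPred_eq, mem_singleton_iff, Complex.ext_iff, mem_union, mem_inter_iff,
    Complex.one_re, Complex.one_im]
  constructor
  · rintro ⟨h, hne⟩
    rcases lt_trichotomy s.im 0 with hi | hi | hi
    · tauto
    · rcases lt_trichotomy s.re 1 with hr | hr | hr <;> tauto
    · tauto
  · rintro ((⟨h, h'⟩ | h) | ⟨h, h'⟩ | ⟨h, h'⟩)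
    · exact ⟨h, fun hc ↦ h'.ne' hc.2⟩
    · exact ⟨by linarith, fun hc ↦ h.ne' hc.1⟩
    · exact ⟨h, fun hc ↦ h'.ne hc.2⟩
    · exact ⟨h, fun hc ↦ h'.ne hc.1⟩

lemma hurwitzZeta_eq_of_re_pos {u : ℝ} (hu : 0 < u) (hu1 : u ≤ 1) {s : ℂ} (hs : 0 < s.re)
    (hs1 : s ≠ 1) :
    HurwitzZeta.hurwitzZeta u s = (u : ℂ) ^ (-s) / 2 + (u : ℂ) ^ (1 - s) / (s - 1) +
      mellin (fun t : ℝ ↦ ((rexp (-u * t) * boseRemainder t : ℝ) : ℂ)) s *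
        (1 / Complex.Gamma s) := by
  have huc : (u : ℂ) ≠ 0 := by exact_mod_cast hu.ne'
  have hopen : IsOpen ({s : ℂ | 0 < s.re} \ {1}) :=
    (isOpen_lt continuous_const Complex.continuous_re).sdiff isClosed_singleton
  have hf : AnalyticOnNhd ℂ (HurwitzZeta.hurwitzZeta u) ({s : ℂ | 0 < s.re} \ {1}) :=
    DifferentiableOn.analyticOnNhd (fun z hz ↦
      (HurwitzZeta.differentiableAt_hurwitzZeta _ hz.2).differentiableWithinAt) hopen
  have hg : AnalyticOnNhd ℂ (fun s : ℂ ↦ (u : ℂ) ^ (-s) / 2 + (u : ℂ) ^ (1 - s) / (s - 1) +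
      mellin (fun t : ℝ ↦ ((rexp (-u * t) * boseRemainder t : ℝ) : ℂ)) s *
        (1 / Complex.Gamma s)) ({s : ℂ | 0 < s.re} \ {1}) := by
    refine DifferentiableOn.analyticOnNhd (fun z hz ↦ ?_) hopen
    have hm : DifferentiableAt ℂ
        (mellin (fun t : ℝ ↦ ((rexp (-u * t) * boseRemainder t : ℝ) : ℂ))) z :=
      mellin_differentiableAt_of_isBigO_rpow_exp (half_pos hu)
        (locallyIntegrableOn_exp_neg_mul_mul_boseRemainder u)
        (isBigO_exp_neg_mul_mul_boseRemainder_atTop hu)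
        (isBigO_exp_neg_mul_mul_boseRemainder_zero hu) hz.1
    have hG : DifferentiableAt ℂ (fun s ↦ 1 / Complex.Gamma s) z := by
      simpa using Complex.differentiable_one_div_Gamma z
    refine DifferentiableAt.differentiableWithinAt ((DifferentiableAt.add ?_ ?_).add (hm.mul hG))
    · exact (differentiableAt_id.neg.const_cpow (.inl huc)).div_const 2
    · exact ((differentiableAt_const _).sub differentiableAt_id |>.const_cpow (.inl huc)).div
        (differentiableAt_id.sub (differentiableAt_const _)) (sub_ne_zero.2 hz.2)
  refine hf.eqOn_of_preconnected_of_eventuallyEq hg isPreconnected_re_pos_diff_one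
    (z₀ := 2) (by simp) ?_ ⟨hs, hs1⟩
  filter_upwards [(isOpen_lt continuous_const Complex.continuous_re).mem_nhds
    (show (1 : ℝ) < (2 : ℂ).re by simp)] with z hz
  exact hurwitzZeta_eq_of_one_lt_re hu hu1 hz

theorem hermite_integral (s : ℝ) (hs : 0 < s) (hs1 : s ≠ 1)
    (u : ℝ) (hu : 0 < u) (hu1 : u ≤ 1) :
    HurwitzZeta.hurwitzZeta u (s : ℂ) =
      ((u ^ (-s) / 2 + u ^ (1 - s) / (s - 1) +
        2 * ∫ x in Ioi (0 : ℝ), Real.sin (s * Real.arctan (x / u)) /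
          ((u ^ 2 + x ^ 2) ^ (s / 2) * (Real.exp (2 * π * x) - 1)) : ℝ) : ℂ) := by
  have hm : mellin (fun t : ℝ ↦ ((rexp (-u * t) * boseRemainder t : ℝ) : ℂ)) s =
      ((∫ t in Ioi (0 : ℝ), t ^ (s - 1) * (rexp (-u * t) * boseRemainder t) : ℝ) : ℂ) := by
    rw [mellin, ← integral_complex_ofReal]
    refine setIntegral_congr_fun measurableSet_Ioi fun t (ht : 0 < t) ↦ ?_
    rw [Complex.ofReal_mul (t ^ (s - 1)), Complex.ofReal_cpow ht.le]
    simp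
  have hG : (Real.Gamma s : ℂ) ≠ 0 := by exact_mod_cast (Real.Gamma_pos_of_pos hs).ne'
  rw [hurwitzZeta_eq_of_re_pos hu hu1 (by simpa using hs) (by exact_mod_cast hs1), hm,
    integral_rpow_mul_exp_neg_mul_mul_boseRemainder hs hu, Complex.Gamma_ofReal]
  rw [Complex.ofReal_add, Complex.ofReal_add, Complex.ofReal_div, Complex.ofReal_div,
    Complex.ofReal_cpow hu.le, Complex.ofReal_cpow hu.le, Complex.ofReal_mul (Real.Gamma s)]
  congr 1
  · push_cast
    rfl
  · rw [mul_one_div, mul_div_cancel_left₀ _ hG]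
end
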